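/- Let G be a near-triangulation that is a vertex-minimal plane graph which is not 3-dynamically L-colorable for some list assignment L with all lists of size at least 6 (so every near-triangulation with fewer vertices is 3-dynamically k-choosable for k = 6). Then every vertex lying on the boundary cycle of the outer face of G has degree at least 4 in G. -/

import Mathlib

open SimpleGraph

/-- A rotation system on a finite connected simple graph: a permutation of the darts that
fixes the tail of each dart and acts transitively on the darts with a given tail
(i.e. a cyclic order of the darts around each vertex). -/
structure RotationSystem (V : Type) [Fintype V] [DecidableEq V] where
  graph : SimpleGraph V
  conn : graph.Connected
  rot : Equiv.Perm graph.Dart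
  rot_fst : ∀ d : graph.Dart, (rot d).fst = d.fst
  rot_orbit : ∀ d e : graph.Dart, d.fst = e.fst → ∃ n : ℕ, (rot ^ n) d = e

namespace RotationSystem

variable {V : Type} [Fintype V] [DecidableEq V] (P : RotationSystem V)

/-- The face-traversal permutation of the darts. -/
def facePerm : Equiv.Perm P.graph.Dart :=
  (Function.Involutive.toPerm _ (Dart.symm_involutive (G := P.graph))).trans P.rot

/-- Two darts lie on (the boundary walk of) the same face. -/
def SameFace (d e : P.graph.Dart) : Prop := P.facePerm.SameCycle d e

/-- The faces of the embedding, as orbits of the face-traversal permutation. -/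
def faceSetoid : Setoid P.graph.Dart :=
  ⟨P.facePerm.SameCycle,
    ⟨fun x => Equiv.Perm.SameCycle.refl _ x, fun h => h.symm, fun h h' => h.trans h'⟩⟩

/-- The number of faces of the embedding. -/
noncomputable def numFaces : ℕ := Nat.card (Quotient P.faceSetoid)

/-- The rotation system is a plane (genus zero) embedding: Euler's formula holds. -/
def IsPlane : Prop :=
  (Fintype.card V : ℤ) - Nat.card P.graph.edgeSet + P.numFaces = 2

/-- The number of darts on the boundary walk of the face containing dart `d`. -/
noncomputable def faceSize (d : P.graph.Dart) : ℕ := Set.ncard {e | P.SameFace d e}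

end RotationSystem

/-- A near-triangulation: a connected plane graph, with a distinguished (outer) face,
all of whose other (bounded) faces are 3-cycles. -/
structure NearTriangulation (V : Type) [Fintype V] [DecidableEq V]
    extends RotationSystem V where
  outer : graph.Dart
  plane : toRotationSystem.IsPlane
  bounded_tri : ∀ d : graph.Dart,
    ¬ toRotationSystem.SameFace outer d → toRotationSystem.faceSize d = 3

/-- A vertex lies on the boundary of the outer face. -/
def NearTriangulation.OnOuter {V : Type} [Fintype V] [DecidableEq V]
    (P : NearTriangulation V) (v : V) : Prop :=
  ∃ d : P.graph.Dart, P.toRotationSystem.SameFace P.outer d ∧ d.fst = v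

/-- An `r`-dynamic coloring: a proper coloring such that each vertex `v` sees at least
`min r (deg v)` distinct colors on its neighborhood. -/
def IsDynColoring {V : Type} (G : SimpleGraph V) (r : ℕ) (φ : V → ℕ) : Prop :=
  (∀ ⦃u v : V⦄, G.Adj u v → φ u ≠ φ v) ∧
  ∀ v : V, min r ((G.neighborSet v).ncard) ≤ (φ '' G.neighborSet v).ncard

open Relation

theorem Relation.ReflTransGen.collapse {α β : Type*} {r : α → α → Prop} {p : β → β → Prop}
    (f : α → β) (h : ∀ a b, r a b → ReflTransGen p (f a) (f b)) {a b : α}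
    (hab : ReflTransGen r a b) : ReflTransGen p (f a) (f b) :=
  ReflTransGen.lift' f h _ _ hab

/-- The map `f` permutes the points satisfying `A` in a single cycle. -/
def CyclicOn {V : Type} (A : V → Prop) (f : V → V) : Prop :=
  (∀ z, A z → A (f z)) ∧
    ∀ z z', A z → A z' → ReflTransGen (fun y y' => A y ∧ f y = y') z z'

/-- Short-circuit the point `p` in a cyclic order. -/
def skipPoint {V : Type} [DecidableEq V] (f : V → V) (p z : V) : V :=
  if f z = p then f p else f z

/-- Insert the point `p` immediately before `q` in a cyclic order. -/
def insertBefore {V : Type} [DecidableEq V] (f : V → V) (p q z : V) : V :=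
  if z = p then q else if f z = q then p else f z

namespace CyclicOn

variable {V : Type} {A : V → Prop} {f : V → V}

theorem eq_of_fixed (h : CyclicOn A f) {z y : V} (hz : A z) (hfz : f z = z) (hy : A y) :
    y = z := by
  have key := h.2 z y hz hy
  induction key with
  | refl => rfl
  | tail _ hs ih =>
    obtain ⟨h1, h2⟩ := hs
    rw [← h2, ih h1, hfz]

theorem eq_or_eq (h : CyclicOn A f) {z y : V} (hz : A z) (hfz : f (f z) = z) (hy : A y) :
    y = z ∨ y = f z := by
  have key := h.2 z y hz hy
  induction key with
  | refl => exact Or.inl rfl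
  | tail _ hs ih =>
    obtain ⟨h1, h2⟩ := hs
    rcases ih h1 with rfl | rfl
    · exact Or.inr h2.symm
    · exact Or.inl (h2.symm.trans hfz)

theorem exists_pred (h : CyclicOn A f) {z : V} (hz : A z) : ∃ y, A y ∧ f y = z := by
  rcases (h.2 (f z) z (h.1 z hz) hz).cases_tail with h1 | ⟨y, _, hy⟩
  · exact ⟨z, hz, h1.symm⟩
  · exact ⟨y, hy⟩

theorem injOn [Finite V] (h : CyclicOn A f) {y z : V} (hy : A y) (hz : A z)
    (hyz : f y = f z) : y = z := by
  let g : {z // A z} → {z // A z} := fun z => ⟨f z, h.1 z z.2⟩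
  have hs : Function.Surjective g := fun z => by
    obtain ⟨y, hy, hyz⟩ := h.exists_pred z.2
    exact ⟨⟨y, hy⟩, Subtype.ext hyz⟩
  have hi : Function.Injective g := Finite.injective_iff_surjective.2 hs
  exact congrArg Subtype.val (@hi ⟨y, hy⟩ ⟨z, hz⟩ (Subtype.ext hyz))

theorem congr {B : V → Prop} {g : V → V} (h : CyclicOn A f) (hAB : ∀ z, B z ↔ A z)
    (hfg : ∀ z, A z → g z = f z) : CyclicOn B g := by
  refine ⟨fun z hz => ?_, fun z z' hz hz' => ?_⟩
  · rw [hAB] at hz ⊢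
    rw [hfg z hz]
    exact h.1 z hz
  · rw [hAB] at hz hz'
    refine ReflTransGen.collapse id ?_ (h.2 z z' hz hz')
    rintro y y' ⟨hy, rfl⟩
    exact ReflTransGen.single ⟨(hAB y).2 hy, hfg y hy⟩

theorem skipPoint [DecidableEq V] (h : CyclicOn A f) {p : V} (hp : f p ≠ p) (hA : A p) :
    CyclicOn (fun z => A z ∧ z ≠ p) (skipPoint f p) := by
  refine ⟨fun z hz => ?_, fun z z' hz hz' => ?_⟩
  · have := h.1 z hz.1
    have := h.1 p hA
    unfold _root_.skipPoint
    grind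
  · have key := ReflTransGen.collapse (p := fun y y' => (A y ∧ y ≠ p) ∧ _root_.skipPoint f p y = y')
      (fun y => if y = p then f p else y) ?_ (h.2 z z' hz.1 hz'.1)
    · simpa [hz.2, hz'.2] using key
    · rintro y y' ⟨hy, rfl⟩
      by_cases hyp : y = p
      · subst hyp
        simp [hp, ReflTransGen.refl]
      · refine ReflTransGen.single ⟨by simp [hyp, hy], ?_⟩
        unfold _root_.skipPoint
        grind

theorem insertBefore [DecidableEq V] (h : CyclicOn A f) {p q : V} (hp : ¬ A p) (hq : A q) :
    CyclicOn (fun z => A z ∨ z = p) (insertBefore f p q) := by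
  have hpq : p ≠ q := by rintro rfl; exact hp hq
  have hstep : ∀ y, A y → ReflTransGen
      (fun y y' => (A y ∨ y = p) ∧ _root_.insertBefore f p q y = y') y (f y) := by
    intro y hy
    have hyp : y ≠ p := by rintro rfl; exact hp hy
    by_cases hyq : f y = q
    · refine (ReflTransGen.single (b := p) ⟨Or.inl hy, ?_⟩).tail ⟨Or.inr rfl, ?_⟩ <;>
      simp [_root_.insertBefore, hyp, hyq]
    · exact ReflTransGen.single ⟨Or.inl hy, by simp [_root_.insertBefore, hyp, hyq]⟩
  have hold : ∀ z z', A z → A z' → ReflTransGen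
      (fun y y' => (A y ∨ y = p) ∧ _root_.insertBefore f p q y = y') z z' := by
    intro z z' hz hz'
    refine ReflTransGen.collapse id ?_ (h.2 z z' hz hz')
    rintro y y' ⟨hy, rfl⟩
    exact hstep y hy
  obtain ⟨r, hr, hrq⟩ := h.exists_pred hq
  have hrp : r ≠ p := by rintro rfl; exact hp hr
  have hto : ReflTransGen
      (fun y y' => (A y ∨ y = p) ∧ _root_.insertBefore f p q y = y') r p :=
    ReflTransGen.single ⟨Or.inl hr, by simp [_root_.insertBefore, hrp, hrq]⟩
  have hfrom : ReflTransGen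
      (fun y y' => (A y ∨ y = p) ∧ _root_.insertBefore f p q y = y') p q :=
    ReflTransGen.single ⟨Or.inr rfl, by simp [_root_.insertBefore]⟩
  refine ⟨fun z hz => ?_, fun z z' hz hz' => ?_⟩
  · unfold _root_.insertBefore
    have := h.1 z
    grind
  · rcases hz with hz | rfl <;> rcases hz' with hz' | rfl
    · exact hold _ _ hz hz'
    · exact (hold _ _ hz hr).trans hto
    · exact hfrom.trans (hold _ _ hq hz')
    · exact ReflTransGen.refl

end CyclicOn

/-- A plane map on the vertex set `verts`, recorded by the cyclic successor function `next u`
on the neighbors of each vertex `u`, whose faces other than `outer` are triangles. Under the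
triangle condition, Euler's formula only involves the numbers of vertices, darts and outer
darts. -/
structure TriMap (V : Type) where
  verts : Finset V
  adj : V → V → Prop
  next : V → V → V
  outer : Set (V × V)
  symm : ∀ {u w}, adj u w → adj w u
  irrefl : ∀ u, ¬ adj u u
  adj_mem : ∀ {u w}, adj u w → u ∈ verts
  conn : ∀ u ∈ verts, ∀ w ∈ verts, ReflTransGen adj u w
  cyclic : ∀ u, CyclicOn (adj u) (next u)
  outer_adj : ∀ {u w}, (u, w) ∈ outer → adj u w
  outer_step : ∀ {u w}, (u, w) ∈ outer → (w, next w u) ∈ outer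
  outer_conn : ∃ o ∈ outer, ∀ q ∈ outer,
    ReflTransGen (fun p p' : V × V => p ∈ outer ∧ (p.2, next p.2 p.1) = p') o q
  tri : ∀ {u w}, adj u w → (u, w) ∉ outer →
    next (next w u) w = u ∧ next u (next w u) = w
  euler : 6 * verts.card = {p : V × V | adj p.1 p.2}.ncard + 2 * outer.ncard + 6

namespace TriMap

variable {V : Type} (T : TriMap V)

theorem next_adj {u w : V} (h : T.adj u w) : T.adj u (T.next u w) := (T.cyclic u).1 w h

theorem mem_outer_of_step {u w : V} (h : T.adj u w) (hs : (w, T.next w u) ∈ T.outer) :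
    (u, w) ∈ T.outer := by
  by_contra hn
  obtain ⟨h1, h2⟩ := T.tri h hn
  have h3 := T.outer_step (T.outer_step hs)
  rw [h1, h2] at h3
  exact hn h3

/-- Delete an edge separating the outer face from a triangle. -/
theorem exists_deleteEdge [Finite V] [DecidableEq V] {v a : V} (hva : (v, a) ∈ T.outer)
    (hav : (a, v) ∉ T.outer) :
    ∃ T' : TriMap V, T'.verts = T.verts ∧
      (∀ u w, T'.adj u w ↔ T.adj u w ∧ ¬ (u = v ∧ w = a) ∧ ¬ (u = a ∧ w = v)) ∧
      (∀ w, T'.next v w = skipPoint (T.next v) a w) ∧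
      (∀ w, T'.next a w = skipPoint (T.next a) v w) ∧
      (∀ u w, u ≠ v → u ≠ a → T'.next u w = T.next u w) ∧
      T'.outer = insert (v, T.next v a) (insert (T.next v a, a) (T.outer \ {(v, a)})) := by
  have hadj := T.outer_adj hva
  have hne : v ≠ a := by rintro rfl; exact T.irrefl _ hadj
  obtain ⟨x, hx⟩ : ∃ x, T.next v a = x := ⟨_, rfl⟩
  obtain ⟨hxa, hax⟩ := T.tri (T.symm hadj) hav
  have hvx := T.next_adj hadj
  have haw := T.next_adj (T.symm hadj)
  rw [hx] at hxa hax hvx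
  have hxa' : T.adj x a := by rw [← hxa]; exact T.next_adj (T.symm hvx)
  have hxne : x ≠ a := by rintro rfl; exact T.irrefl _ hxa'
  have hxv : x ≠ v := by rintro rfl; exact T.irrefl _ hvx
  have hwv : T.next a v ≠ v := fun h =>
    hxv ((T.cyclic a).eq_of_fixed (T.symm hadj) h (T.symm hxa'))
  have hvxO : (v, x) ∉ T.outer := fun h => hav (T.mem_outer_of_step (T.symm hadj) (hx ▸ h))
  have hxaO : (x, a) ∉ T.outer := fun h => hvxO (T.mem_outer_of_step hvx (hxa.symm ▸ h))
  obtain ⟨nxt, hnxt⟩ : ∃ nxt : V → V → V, ∀ u w, nxt u w =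
      if u = v then skipPoint (T.next v) a w
      else if u = a then skipPoint (T.next a) v w else T.next u w := ⟨_, fun _ _ => rfl⟩
  refine ⟨{ verts := T.verts
            adj := fun u w => T.adj u w ∧ ¬ (u = v ∧ w = a) ∧ ¬ (u = a ∧ w = v)
            next := nxt
            outer := insert (v, x) (insert (x, a) (T.outer \ {(v, a)}))
            symm := fun ⟨h, h1, h2⟩ => ⟨T.symm h, fun h' => h2 h'.symm, fun h' => h1 h'.symm⟩
            irrefl := fun u h => T.irrefl u h.1
            adj_mem := fun h => T.adj_mem h.1
            conn := ?_
            cyclic := ?_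
            outer_adj := ?_
            outer_step := ?_
            outer_conn := ?_
            tri := ?_
            euler := ?_ }, rfl, fun u w => Iff.rfl, by simp [hnxt],
            by simp [hnxt, hne.symm],
            by intros; simp [*], by simp [hx]⟩
  · intro u hu w hw
    refine ReflTransGen.collapse id ?_ (T.conn u hu w hw)
    intro u w h
    by_cases h1 : u = v ∧ w = a
    · obtain ⟨rfl, rfl⟩ := h1
      exact (ReflTransGen.single (b := x) ⟨hvx, by grind, by grind⟩).tail
        ⟨hxa', by grind, by grind⟩
    by_cases h2 : u = a ∧ w = v
    · obtain ⟨rfl, rfl⟩ := h2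
      exact (ReflTransGen.single (b := x) ⟨T.symm hxa', by grind, by grind⟩).tail
        ⟨T.symm hvx, by grind, by grind⟩
    exact ReflTransGen.single ⟨h, h1, h2⟩
  · intro u
    by_cases huv : u = v
    · subst huv
      refine ((T.cyclic u).skipPoint (hx ▸ hxne) hadj).congr (by grind) (by simp [hnxt])
    by_cases hua : u = a
    · subst hua
      refine ((T.cyclic u).skipPoint hwv (T.symm hadj)).congr (by grind) (by simp [hnxt, hne.symm])
    · exact (T.cyclic u).congr (by grind) (by simp [hnxt, huv, hua])
  · have := @T.outer_adj
    grind
  · intro u w h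
    have h1 := @T.outer_step u w
    have h2 := @T.outer_step v a hva
    simp only [hnxt, skipPoint, Set.mem_insert_iff, Set.mem_sdiff, Set.mem_singleton_iff,
      Prod.mk.injEq] at h ⊢
    grind
  · obtain ⟨o, ho, hreach⟩ := T.outer_conn
    let g : V × V → V × V := fun p => if p = (v, a) then (v, x) else p
    refine ⟨g o, by grind, fun q hq => ?_⟩
    set R : V × V → V × V → Prop := _ with hR
    change ReflTransGen R (g o) q
    have hx1 : R (v, x) (x, a) := by simp [hR, hnxt, hxa, hxv, hxne]
    have hx2 : R (x, a) (a, T.next a v) := by simp [hR, hnxt, hax, hne.symm, skipPoint]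
    have key : ∀ q ∈ T.outer, ReflTransGen R (g o) (g q) := by
      intro q hq
      refine ReflTransGen.collapse g ?_ (hreach q hq)
      rintro ⟨y, z⟩ _ ⟨hp, rfl⟩
      by_cases hp1 : (y, z) = (v, a)
      · obtain ⟨rfl, rfl⟩ := Prod.mk.injEq _ _ _ _ ▸ hp1
        have : g (z, T.next z y) = (z, T.next z y) := by grind
        simp only [this]
        have : g (y, z) = (y, x) := by grind
        rw [this]
        exact (ReflTransGen.single hx1).tail hx2
      · have : g (y, z) = (y, z) := by grind
        rw [this]
        have h1 := T.outer_step hp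
        refine ReflTransGen.single ⟨by grind, ?_⟩
        simp only [hnxt, skipPoint, g]
        grind
    simp only [Set.mem_insert_iff, Set.mem_sdiff, Set.mem_singleton_iff] at hq
    have hg : ReflTransGen R (g o) (v, x) := by
      have := key _ hva
      rwa [show g (v, a) = (v, x) by grind] at this
    rcases hq with rfl | rfl | ⟨hq, hq'⟩
    · exact hg
    · exact hg.tail hx1
    · have := key _ hq
      rwa [show g q = q by grind] at this
  · intro u w h hO
    have h1 := @T.tri u w
    have h2 := T.mem_outer_of_step h.1
    have h3 := T.next_adj (T.symm h.1)
    have h4 := T.mem_outer_of_step h3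
    simp only [Set.mem_insert_iff, Set.mem_sdiff, Set.mem_singleton_iff,
      Prod.mk.injEq] at h hO ⊢
    have hO' : (u, w) ∉ T.outer := by grind
    obtain ⟨h5, h6⟩ := h1 h.1 hO'
    have e1 : nxt w u = T.next w u := by
      simp only [hnxt, skipPoint]
      grind
    rw [e1]
    simp only [hnxt, skipPoint]
    constructor <;> grind
  · have h1 : {p : V × V | T.adj p.1 p.2 ∧ ¬ (p.1 = v ∧ p.2 = a) ∧ ¬ (p.1 = a ∧ p.2 = v)} =
        {p : V × V | T.adj p.1 p.2} \ {(v, a), (a, v)} := by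
      ext ⟨p, q⟩; simp
    have h2 : ({(v, a), (a, v)} : Set (V × V)).ncard = 2 := Set.ncard_pair (by grind)
    have h3 := Set.ncard_sdiff_add_ncard_of_subset (s := {(v, a), (a, v)})
      (t := {p : V × V | T.adj p.1 p.2}) (by
        rintro p (rfl | rfl)
        exacts [hadj, T.symm hadj])
    have h4 := Set.ncard_sdiff_singleton_add_one hva
    rw [Set.ncard_insert_of_notMem (by grind), Set.ncard_insert_of_notMem (by grind), h1, T.euler]
    omega

/-- Delete a vertex of degree one. -/
theorem exists_deleteLeaf [Finite V] [DecidableEq V] {u v : V} (hvu : T.adj v u)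
    (hleaf : T.next v u = u) (hu : T.next u v ≠ v) :
    ∃ T' : TriMap V, T'.verts = T.verts.erase v ∧
      (∀ y z, T'.adj y z ↔ T.adj y z ∧ y ≠ v ∧ z ≠ v) ∧
      (∀ z, T'.next u z = skipPoint (T.next u) v z) ∧
      (∀ y z, y ≠ u → T'.next y z = T.next y z) ∧
      T'.outer = T.outer \ {(v, u), (u, v)} := by
  have hne : v ≠ u := by rintro rfl; exact T.irrefl _ hvu
  have honly : ∀ z, T.adj v z → z = u := fun z hz => (T.cyclic v).eq_of_fixed hvu hleaf hz
  have huvO : (u, v) ∈ T.outer := by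
    by_contra h
    have h1 := (T.tri (T.symm hvu) h).1
    have h2 := T.next_adj (T.symm hvu)
    rw [hleaf] at h1
    rw [h1] at h2
    exact T.irrefl u h2
  have hvuO : (v, u) ∈ T.outer := hleaf ▸ T.outer_step huvO
  have hw := T.outer_step hvuO
  obtain ⟨nxt, hnxt⟩ : ∃ nxt : V → V → V, ∀ y z, nxt y z =
      if y = u then skipPoint (T.next u) v z else T.next y z := ⟨_, fun _ _ => rfl⟩
  refine ⟨{ verts := T.verts.erase v
            adj := fun y z => T.adj y z ∧ y ≠ v ∧ z ≠ v
            next := nxt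
            outer := T.outer \ {(v, u), (u, v)}
            symm := fun ⟨h, h1, h2⟩ => ⟨T.symm h, h2, h1⟩
            irrefl := fun u h => T.irrefl u h.1
            adj_mem := fun h => Finset.mem_erase.2 ⟨h.2.1, T.adj_mem h.1⟩
            conn := ?_
            cyclic := ?_
            outer_adj := ?_
            outer_step := ?_
            outer_conn := ?_
            tri := ?_
            euler := ?_ }, rfl, fun y z => Iff.rfl, by simp [hnxt], by simp +contextual [hnxt],
            rfl⟩
  · intro y hy z hz
    rw [Finset.mem_erase] at hy hz
    have := ReflTransGen.collapse (p := fun y z => T.adj y z ∧ y ≠ v ∧ z ≠ v)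
      (fun z => if z = v then u else z) ?_ (T.conn y hy.2 z hz.2)
    · simpa [hy.1, hz.1] using this
    · intro y z h
      by_cases hyv : y = v
      · subst hyv
        rw [honly z h]
        simp [hne.symm, ReflTransGen.refl]
      by_cases hzv : z = v
      · subst hzv
        rw [honly y (T.symm h)]
        simp [hne.symm, ReflTransGen.refl]
      exact ReflTransGen.single (by simp [hyv, hzv, h])
  · intro y
    by_cases hyu : y = u
    · subst hyu
      refine ((T.cyclic y).skipPoint hu (T.symm hvu)).congr (by grind) (by simp [hnxt])
    by_cases hyv : y = v
    · subst hyv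
      exact ⟨by grind, by grind⟩
    · refine (T.cyclic y).congr (fun z => ⟨And.left, fun h => ⟨h, hyv, ?_⟩⟩) (by simp [hnxt, hyu])
      rintro rfl
      exact hyu (honly y (T.symm h))
  · intro y z h
    have h1 := T.outer_adj h.1
    have h2 := honly z
    have h3 := honly y
    have h4 := T.symm h1
    grind
  · intro y z h
    have h1 := @T.outer_step y z
    have h2 := T.next_adj (T.symm hvu)
    have h3 := honly (T.next z y)
    have h4 := T.outer_adj h.1
    have h5 := T.next_adj (T.symm h4)
    have h6 := honly z
    have h7 := T.symm h5
    have h8 := honly y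
    have h9 := T.symm h4
    simp only [hnxt, skipPoint, Set.mem_insert_iff, Set.mem_sdiff, Set.mem_singleton_iff,
      Prod.mk.injEq] at h ⊢
    grind
  · obtain ⟨o, ho, hreach⟩ := T.outer_conn
    let g : V × V → V × V := fun p => if p = (v, u) ∨ p = (u, v) then (u, T.next u v) else p
    have hg : ∀ p ∈ T.outer, g p ∈ T.outer \ {(v, u), (u, v)} := by
      intro p hp
      by_cases hp1 : p = (v, u) ∨ p = (u, v)
      · simp [g, hp1, hw, hne.symm, hu]
      · simpa [g, hp1] using hp
    refine ⟨g o, hg o ho, fun q hq => ?_⟩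
    rw [show q = g q by grind]
    refine ReflTransGen.collapse g ?_ (hreach q hq.1)
    rintro ⟨y, z⟩ _ ⟨hp, rfl⟩
    have h1 := T.outer_step hp
    have h2 := honly z
    have h3 := T.outer_adj h1
    have h4 := honly (T.next z y)
    have h5 := T.symm h3
    have h6 := honly y
    have h8 := T.symm (T.outer_adj hp)
    by_cases hp1 : (y, z) = (v, u) ∨ (y, z) = (u, v)
    · have : g (y, z) = g (z, T.next z y) := by grind
      simp only [this, ReflTransGen.refl]
    · refine ReflTransGen.single ⟨hg _ hp, ?_⟩
      have h7 := hg _ h1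
      have : g (y, z) = (y, z) := by grind
      simp only [this, hnxt, skipPoint]
      grind
  · intro y z h hO
    have hO' : (y, z) ∉ T.outer := by grind
    have h1 := T.tri h.1 hO'
    have h3 := T.next_adj (T.symm h.1)
    have h4 := T.mem_outer_of_step h.1
    have h5 := T.mem_outer_of_step h3
    have e1 : nxt z y = T.next z y := by
      simp only [hnxt, skipPoint]
      grind
    rw [e1]
    simp only [hnxt, skipPoint]
    grind
  · have h1 : {p : V × V | T.adj p.1 p.2 ∧ p.1 ≠ v ∧ p.2 ≠ v} =
        {p : V × V | T.adj p.1 p.2} \ {(v, u), (u, v)} := by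
      ext ⟨p, q⟩
      have h2 := honly q
      have h3 := honly p
      have h4 := @T.symm p q
      have h5 := @T.symm q p
      simp
      grind
    have h2 : ({(v, u), (u, v)} : Set (V × V)).ncard = 2 := Set.ncard_pair (by grind)
    have h3 := Set.ncard_sdiff_add_ncard_of_subset (s := {(v, u), (u, v)})
      (t := {p : V × V | T.adj p.1 p.2}) (by
        rintro p (rfl | rfl)
        exacts [hvu, T.symm hvu])
    have h4 := Set.ncard_sdiff_add_ncard_of_subset (s := {(v, u), (u, v)})
      (t := T.outer) (by
        rintro p (rfl | rfl)
        exacts [hvuO, huvO])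
    have h5 := Finset.card_erase_add_one (T.adj_mem hvu)
    have h6 := T.euler
    rw [h1]
    omega

/-- Add an edge inside the outer face, cutting off a triangle. -/
theorem exists_addEdge [Finite V] [DecidableEq V] {a b x : V} (hbx : (b, x) ∈ T.outer)
    (hxa : T.next x b = a) (hba : b ≠ a) (hnab : ¬ T.adj a b) :
    ∃ T' : TriMap V, T'.verts = T.verts ∧
      (∀ u w, T'.adj u w ↔ T.adj u w ∨ (u = a ∧ w = b) ∨ (u = b ∧ w = a)) := by
  have hxaO : (x, a) ∈ T.outer := hxa ▸ T.outer_step hbx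
  have hadjbx := T.outer_adj hbx
  have hadjxa := T.outer_adj hxaO
  have hbxne : b ≠ x := by rintro rfl; exact T.irrefl _ hadjbx
  have hxane : x ≠ a := by rintro rfl; exact T.irrefl _ hadjxa
  have hnba : ¬ T.adj b a := fun h => hnab (T.symm h)
  obtain ⟨w, hw⟩ : ∃ w, T.next a x = w := ⟨_, rfl⟩
  have hawO : (a, w) ∈ T.outer := hw ▸ T.outer_step hxaO
  have hadjaw := T.outer_adj hawO
  have hinj : ∀ y, T.adj x y → T.next x y = a → y = b := fun y hy hya =>
    (T.cyclic x).injOn hy (T.symm hadjbx) (hya.trans hxa.symm)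
  have hinj' : ∀ y, T.adj a y → T.next a y = w → y = x := fun y hy hya =>
    (T.cyclic a).injOn hy (T.symm hadjxa) (hya.trans hw.symm)
  obtain ⟨nxt, hnxt⟩ : ∃ nxt : V → V → V, ∀ u z, nxt u z =
      if u = a then insertBefore (T.next a) b w z
      else if u = b then insertBefore (T.next b) a x z else T.next u z := ⟨_, fun _ _ => rfl⟩
  refine ⟨{ verts := T.verts
            adj := fun u w => T.adj u w ∨ (u = a ∧ w = b) ∨ (u = b ∧ w = a)
            next := nxt
            outer := insert (b, a) (T.outer \ {(b, x), (x, a)})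
            symm := ?_
            irrefl := ?_
            adj_mem := ?_
            conn := ?_
            cyclic := ?_
            outer_adj := ?_
            outer_step := ?_
            outer_conn := ?_
            tri := ?_
            euler := ?_ }, rfl, fun y z => Iff.rfl⟩
  · intro u w h
    have := @T.symm u w
    grind
  · intro u h
    have := T.irrefl u
    grind
  · rintro u w (h | ⟨rfl, rfl⟩ | ⟨rfl, rfl⟩)
    exacts [T.adj_mem h, T.adj_mem (T.symm hadjxa), T.adj_mem hadjbx]
  · intro y hy z hz
    refine ReflTransGen.collapse id ?_ (T.conn y hy z hz)
    exact fun _ _ h => ReflTransGen.single (Or.inl h)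
  · intro u
    by_cases hua : u = a
    · subst hua
      exact ((T.cyclic u).insertBefore hnab hadjaw).congr (by grind) (by simp [hnxt])
    by_cases hub : u = b
    · subst hub
      exact ((T.cyclic u).insertBefore hnba hadjbx).congr (by grind) (by simp [hnxt, hba])
    · exact (T.cyclic u).congr (by grind) (by simp [hnxt, hua, hub])
  · have := @T.outer_adj
    grind
  · intro u z h
    have h1 := @T.outer_step u z
    have h2 := @T.outer_adj u z
    have h3 := hinj u
    have h4 := @T.symm u z
    have h5 := T.symm hadjbx
    simp only [hnxt, insertBefore, Set.mem_insert_iff, Set.mem_sdiff, Set.mem_singleton_iff,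
      Prod.mk.injEq] at h ⊢
    grind
  · obtain ⟨o, ho, hreach⟩ := T.outer_conn
    let g : V × V → V × V := fun p => if p = (b, x) ∨ p = (x, a) then (b, a) else p
    have hg : ∀ p ∈ T.outer, g p ∈ insert (b, a) (T.outer \ {(b, x), (x, a)}) := by grind
    have hba' : (b, a) ∉ T.outer := fun h => hnba (T.outer_adj h)
    refine ⟨g o, hg o ho, fun q hq => ?_⟩
    set R : V × V → V × V → Prop := _ with hR
    change ReflTransGen R (g o) q
    have key : ∀ q ∈ T.outer, ReflTransGen R (g o) (g q) := by
      intro q hq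
      refine ReflTransGen.collapse g ?_ (hreach q hq)
      rintro ⟨y, z⟩ _ ⟨hp, rfl⟩
      have h1 := T.outer_step hp
      have h2 := @T.outer_adj y z hp
      have h3 := hinj y
      have h4 := @T.symm y z
      have h5 := T.symm hadjbx
      by_cases hp1 : (y, z) = (b, x)
      · have : g (y, z) = g (z, T.next z y) := by grind
        simp only [this, ReflTransGen.refl]
      · refine ReflTransGen.single ⟨hg _ hp, ?_⟩
        simp only [g, hnxt, insertBefore]
        grind
    rcases hq with rfl | hq
    · have := key _ hbx
      rwa [show g (b, x) = (b, a) by grind] at this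
    · have := key _ hq.1
      rwa [show g q = q by grind] at this
  · intro u z h hO
    by_cases hO' : (u, z) ∈ T.outer
    · simp only [hnxt, insertBefore]
      grind
    by_cases hadj : T.adj u z
    · obtain ⟨h1, h2⟩ := T.tri hadj hO'
      have h3 := T.next_adj (T.symm hadj)
      have h4 := mt (T.mem_outer_of_step hadj) hO'
      have h5 := mt (T.mem_outer_of_step h3) h4
      have h6 := T.next_adj (T.symm h3)
      generalize hy : T.next z u = y at h1 h2 h3 h4 h5 h6
      rw [h1] at h5 h6
      have h7 := hinj' z
      have h8 := hinj' y
      have h9 := hinj' u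
      have h10 := T.symm h6
      have h11 := T.symm h3
      have e1 : nxt z u = y := by
        simp only [hnxt, insertBefore]
        grind
      rw [e1]
      simp only [hnxt, insertBefore]
      grind
    · simp only [hnxt, insertBefore]
      grind
  · have h1 : {p : V × V | T.adj p.1 p.2 ∨ (p.1 = a ∧ p.2 = b) ∨ (p.1 = b ∧ p.2 = a)} =
        insert (a, b) (insert (b, a) {p : V × V | T.adj p.1 p.2}) := by
      ext ⟨p, q⟩
      simp
      grind
    have h2 : ({(b, x), (x, a)} : Set (V × V)).ncard = 2 := Set.ncard_pair (by grind)
    have h4 := Set.ncard_sdiff_add_ncard_of_subset (s := {(b, x), (x, a)})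
      (t := T.outer) (by
        rintro p (rfl | rfl)
        exacts [hbx, hxaO])
    have hba' : (b, a) ∉ T.outer := fun h => hnba (T.outer_adj h)
    have h6 := T.euler
    rw [h1, Set.ncard_insert_of_notMem (by simp [hnab, hba.symm]),
      Set.ncard_insert_of_notMem (by simpa using hnba), Set.ncard_insert_of_notMem (by grind)]
    omega

end TriMap

/-- If all classes of an equivalence relation but that of `o` have three elements, the number of
classes is determined by the size of the class of `o`. -/
theorem Setoid.card_add_three_of_ncard_eq_three {D : Type*} [Finite D] (s : Setoid D) (o : D)
    (h : ∀ d, ¬ s o d → {e | s d e}.ncard = 3) :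
    Nat.card D + 3 = {e | s o e}.ncard + 3 * Nat.card (Quotient s) := by
  classical
  have := Fintype.ofFinite D
  have := Fintype.ofFinite (Quotient s)
  have hfib : ∀ d, (Finset.univ.filter fun e => Quotient.mk s e = Quotient.mk s d).card =
      {e | s d e}.ncard := by
    intro d
    rw [← Set.ncard_coe_finset]
    congr 1
    ext e
    simp only [Finset.coe_filter, Finset.mem_univ, true_and, Set.mem_ofPred_eq, Quotient.eq]
    exact ⟨s.symm, s.symm⟩
  have hsum : Fintype.card D = ∑ q : Quotient s,
      (Finset.univ.filter fun e => Quotient.mk s e = q).card :=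
    Finset.card_eq_sum_card_fiberwise fun _ _ => Finset.mem_coe.2 (Finset.mem_univ _)
  have hrest : ∑ q ∈ Finset.univ.erase (Quotient.mk s o),
      (Finset.univ.filter fun e => Quotient.mk s e = q).card =
      ∑ q ∈ Finset.univ.erase (Quotient.mk s o), 3 := by
    refine Finset.sum_congr rfl fun q hq => ?_
    induction q using Quotient.inductionOn with
    | h d =>
      rw [hfib, h]
      intro hod
      exact (Finset.mem_erase.1 hq).1 (Quotient.sound hod).symm
  rw [← Finset.add_sum_erase _ _ (Finset.mem_univ (Quotient.mk s o)), hrest, hfib,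
    Finset.sum_const, smul_eq_mul] at hsum
  have hcard := Finset.card_erase_add_one (Finset.mem_univ (Quotient.mk s o))
  rw [Finset.card_univ] at hcard
  rw [Nat.card_eq_fintype_card, Nat.card_eq_fintype_card]
  omega

instance SimpleGraph.Dart.finite {V : Type} [Finite V] (G : SimpleGraph V) : Finite G.Dart :=
  Finite.of_injective _ Dart.toProd_injective

theorem SimpleGraph.card_dart_eq_two_mul_card_edgeSet {V : Type} [Finite V] (G : SimpleGraph V) :
    Nat.card G.Dart = 2 * Nat.card G.edgeSet := by
  classical
  have := Fintype.ofFinite V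
  rw [Nat.card_eq_fintype_card, dart_card_eq_twice_card_edges, Nat.card_eq_fintype_card,
    edgeFinset_card]

theorem SimpleGraph.card_dart_eq_ncard {V : Type} (G : SimpleGraph V) :
    Nat.card G.Dart = {p : V × V | G.Adj p.1 p.2}.ncard := by
  rw [← Nat.card_coe_set_eq]
  exact Nat.card_congr ⟨fun d => ⟨d.toProd, d.adj⟩, fun p => ⟨p.1, p.2⟩, fun _ => rfl, fun _ => rfl⟩

theorem Equiv.Perm.pow_ncard_sameCycle_apply {D : Type*} [Finite D] {f : Equiv.Perm D} {x : D}
    (h : f x ≠ x) : (f ^ {y | f.SameCycle x y}.ncard) x = x := by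
  classical
  have := Fintype.ofFinite D
  have hset : {y | f.SameCycle x y} = (f.cycleOf x).support := by
    ext y
    rw [Set.mem_ofPred_eq, Finset.mem_coe, mem_support_cycleOf_iff,
      and_iff_left (mem_support.2 h)]
  rw [hset, Set.ncard_coe_finset, ← pow_mod_card_support_cycleOf_self_apply, Nat.mod_self]
  simp

theorem Equiv.Perm.ncard_sameCycle_eq_three {D : Type*} [Finite D] {f : Equiv.Perm D} {x : D}
    (h : f x ≠ x) (h3 : f (f (f x)) = x) : {y | f.SameCycle x y}.ncard = 3 := by
  have hset : {y | f.SameCycle x y} = {x, f x, f (f x)} := by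
    ext y
    constructor
    · intro hy
      obtain ⟨n, rfl⟩ := Equiv.Perm.SameCycle.exists_nat_pow_eq hy
      clear hy
      induction n with
      | zero => simp
      | succ n ih =>
        rw [pow_succ', mul_apply]
        rcases ih with ih | ih | ih <;> rw [ih] <;> simp [h3]
    · rintro (rfl | rfl | rfl)
      · exact .refl _ _
      · exact (SameCycle.refl f x).apply_right
      · exact (SameCycle.refl f x).apply_right.apply_right
  have h2 : f (f x) ≠ x := fun h2 => h (by rwa [h2] at h3)
  rw [hset, Set.ncard_eq_three]
  exact ⟨x, f x, f (f x), h.symm, h2.symm, fun h' => h (f.injective h').symm, rfl⟩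

namespace RotationSystem

variable {V : Type} [Fintype V] [DecidableEq V] (P : RotationSystem V)

theorem facePerm_fst (d : P.graph.Dart) : (P.facePerm d).fst = d.snd := P.rot_fst d.symm

theorem facePerm_ne (d : P.graph.Dart) : P.facePerm d ≠ d := fun h =>
  d.fst_ne_snd (by rw [← P.facePerm_fst, h])

/-- Euler's formula for a map all of whose faces but one are triangles. -/
theorem isPlane_iff (o : P.graph.Dart) (h : ∀ d, ¬ P.SameFace o d → P.faceSize d = 3) :
    P.IsPlane ↔ 6 * Fintype.card V =
      {p : V × V | P.graph.Adj p.1 p.2}.ncard + 2 * P.faceSize o + 6 := by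
  have h1 := P.faceSetoid.card_add_three_of_ncard_eq_three o h
  have h2 := P.graph.card_dart_eq_two_mul_card_edgeSet
  have h3 := P.graph.card_dart_eq_ncard
  have h4 : P.faceSize o = {e | P.faceSetoid o e}.ncard := rfl
  unfold IsPlane numFaces
  rw [h4]
  omega

open Classical in
/-- The neighbor of `u` following `w` in the rotation at `u`. -/
noncomputable def next (u w : V) : V :=
  if h : P.graph.Adj u w then (P.rot ⟨(u, w), h⟩).snd else w

theorem rot_eq (d : P.graph.Dart) : (P.rot d).toProd = (d.fst, P.next d.fst d.snd) := by
  have h : P.graph.Adj d.fst d.snd := d.adj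
  refine Prod.ext (P.rot_fst d) ?_
  simp [next, h]

theorem facePerm_eq (d : P.graph.Dart) :
    (P.facePerm d).toProd = (d.snd, P.next d.snd d.fst) := P.rot_eq d.symm

theorem cyclicOn_next (u : V) : CyclicOn (P.graph.Adj u) (P.next u) := by
  constructor
  · intro w h
    have := (P.rot ⟨(u, w), h⟩).adj
    rwa [P.rot_eq] at this
  · intro w w' h h'
    obtain ⟨n, hn⟩ := P.rot_orbit ⟨(u, w), h⟩ ⟨(u, w'), h'⟩ rfl
    have key : ∀ n : ℕ, ((P.rot ^ n) ⟨(u, w), h⟩).fst = u ∧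
        ReflTransGen (fun y y' => P.graph.Adj u y ∧ P.next u y = y') w
          ((P.rot ^ n) ⟨(u, w), h⟩).snd := by
      intro n
      induction n with
      | zero => exact ⟨rfl, ReflTransGen.refl⟩
      | succ n ih =>
        obtain ⟨ih1, ih2⟩ := ih
        rw [pow_succ', Equiv.Perm.mul_apply]
        have hadj := ((P.rot ^ n) ⟨(u, w), h⟩).adj
        rw [P.rot_eq]
        refine ⟨ih1, ih2.tail ⟨?_, ?_⟩⟩
        · rwa [ih1] at hadj
        · rw [ih1]
    have := (key n).2
    rwa [hn] at this

end RotationSystem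

namespace NearTriangulation

variable {V : Type} [Fintype V] [DecidableEq V] (P : NearTriangulation V)

/-- The triangulated map underlying a near-triangulation. -/
noncomputable def toTriMap : TriMap V where
  verts := Finset.univ
  adj := P.graph.Adj
  next := P.next
  outer := {p | ∃ h : P.graph.Adj p.1 p.2, P.SameFace P.outer ⟨p, h⟩}
  symm h := h.symm
  irrefl u h := P.graph.irrefl h
  adj_mem _ := Finset.mem_univ _
  conn u _ w _ := (reachable_iff_reflTransGen u w).1 (P.conn.preconnected u w)
  cyclic := P.cyclicOn_next
  outer_adj := fun ⟨h, _⟩ => h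
  outer_step := by
    rintro u w ⟨h, hs⟩
    have h1 : P.SameFace P.outer (P.facePerm ⟨(u, w), h⟩) := hs.apply_right
    have h2 := P.facePerm_eq ⟨(u, w), h⟩
    have h3 := (P.facePerm ⟨(u, w), h⟩).adj
    rw [h2] at h3
    exact ⟨h3, (Dart.ext _ ⟨(w, P.next w u), h3⟩ h2) ▸ h1⟩
  outer_conn := by
    refine ⟨P.outer.toProd, ⟨P.outer.adj, .refl _ _⟩, ?_⟩
    rintro q ⟨hq, hs⟩
    obtain ⟨n, hn⟩ := Equiv.Perm.SameCycle.exists_nat_pow_eq hs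
    obtain rfl : ((P.facePerm ^ n) P.outer).toProd = q := by rw [hn]
    clear hq hs hn
    induction n with
    | zero => exact .refl
    | succ n ih =>
      refine ih.tail ⟨⟨((P.facePerm ^ n) P.outer).adj, n, ?_⟩, ?_⟩
      · rfl
      · rw [pow_succ', Equiv.Perm.mul_apply, P.facePerm_eq]
  tri := by
    intro u w h hO
    have h3 := P.bounded_tri ⟨(u, w), h⟩ fun hs => hO ⟨h, hs⟩
    have h4 := Equiv.Perm.pow_ncard_sameCycle_apply (P.facePerm_ne ⟨(u, w), h⟩)
    have h5 : {y | P.facePerm.SameCycle ⟨(u, w), h⟩ y}.ncard = 3 := h3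
    rw [h5] at h4
    have h6 := congrArg Dart.toProd h4
    have e : ∀ d, (P.facePerm ^ 3) d = P.facePerm (P.facePerm (P.facePerm d)) := fun _ => rfl
    rw [e, P.facePerm_eq] at h6
    simp only [P.facePerm_eq, Prod.mk.injEq] at h6
    exact ⟨h6.1, by simpa only [h6.1] using h6.2⟩
  euler := by
    have h1 := (P.isPlane_iff P.outer P.bounded_tri).1 P.plane
    rw [Finset.card_univ, h1]
    congr 3
    unfold RotationSystem.faceSize
    rw [← Set.ncard_image_of_injective _ Dart.toProd_injective]
    congr 1
    ext p
    constructor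
    · rintro ⟨d, hd, rfl⟩
      exact ⟨d.adj, hd⟩
    · rintro ⟨h, hd⟩
      exact ⟨_, hd, rfl⟩

end NearTriangulation

namespace TriMap

variable {V : Type} (T : TriMap V)

/-- The graph underlying a triangulated map. -/
def graph : SimpleGraph {w // w ∈ T.verts} where
  Adj u w := T.adj u w
  symm := ⟨fun _ _ h => T.symm h⟩
  loopless := ⟨fun u h => T.irrefl u h⟩

theorem graph_connected : T.graph.Connected := by
  obtain ⟨⟨a, b⟩, ho, -⟩ := T.outer_conn
  have : Nonempty {w // w ∈ T.verts} := ⟨⟨a, T.adj_mem (T.outer_adj ho)⟩⟩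
  refine ⟨fun u w => (reachable_iff_reflTransGen u w).2 ?_⟩
  have key : ∀ z : V, ReflTransGen T.adj u z →
      ∃ hz : z ∈ T.verts, ReflTransGen T.graph.Adj u ⟨z, hz⟩ := by
    intro z h
    induction h with
    | refl => exact ⟨u.2, .refl⟩
    | tail _ h ih =>
      obtain ⟨hy, ih⟩ := ih
      exact ⟨T.adj_mem (T.symm h), ih.tail h⟩
  exact (key w (T.conn u u.2 w w.2)).2

/-- The successor of a dart in the rotation at its tail. -/
def rotDart (d : T.graph.Dart) : T.graph.Dart :=
  ⟨(d.fst, ⟨T.next d.fst d.snd, T.adj_mem (T.symm (T.next_adj d.adj))⟩), T.next_adj d.adj⟩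

theorem rotDart_injective [Finite V] : Function.Injective T.rotDart := by
  intro d e h
  have h1 : (T.rotDart d).fst = (T.rotDart e).fst := by rw [h]
  have h2 : ((T.rotDart d).snd : V) = (T.rotDart e).snd := by rw [h]
  change d.fst = e.fst at h1
  change T.next d.fst d.snd = T.next e.fst e.snd at h2
  rw [h1] at h2
  have h3 : T.adj e.fst d.snd := h1 ▸ d.adj
  exact Dart.ext _ _ (Prod.ext h1 (Subtype.ext ((T.cyclic e.fst).injOn h3 e.adj h2)))

/-- The rotation system underlying a triangulated map. -/
noncomputable def toRotationSystem [Fintype V] [DecidableEq V] :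
    RotationSystem {w // w ∈ T.verts} where
  graph := T.graph
  conn := T.graph_connected
  rot := Equiv.ofBijective T.rotDart (Finite.injective_iff_bijective.1 T.rotDart_injective)
  rot_fst _ := rfl
  rot_orbit := by
    intro d e h
    have key : ∀ z, ReflTransGen (fun y y' => T.adj d.fst y ∧ T.next d.fst y = y') d.snd z →
        ∃ n : ℕ, ∃ h : T.adj d.fst z, ((Equiv.ofBijective T.rotDart
          (Finite.injective_iff_bijective.1 T.rotDart_injective)) ^ n) d =
            ⟨(d.fst, ⟨z, T.adj_mem (T.symm h)⟩), h⟩ := by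
      intro z hz
      induction hz with
      | refl => exact ⟨0, d.adj, rfl⟩
      | tail _ h ih =>
        obtain ⟨n, h1, ih⟩ := ih
        obtain ⟨-, rfl⟩ := h
        refine ⟨n + 1, T.next_adj h1, ?_⟩
        rw [pow_succ', Equiv.Perm.mul_apply, ih]
        rfl
    have h1 : T.adj d.fst e.snd := h ▸ e.adj
    obtain ⟨n, h2, hn⟩ := key _ ((T.cyclic d.fst).2 _ _ d.adj h1)
    exact ⟨n, hn.trans (Dart.ext _ _ (Prod.ext h rfl))⟩

variable [Fintype V] [DecidableEq V]

theorem sameFace_toRotationSystem : ∃ o : T.toRotationSystem.graph.Dart,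
    ∀ d : T.toRotationSystem.graph.Dart,
      T.toRotationSystem.SameFace o d ↔ ((d.fst : V), (d.snd : V)) ∈ T.outer := by
  obtain ⟨⟨a, b⟩, ho, hconn⟩ := T.outer_conn
  have hab := T.outer_adj ho
  let o : T.toRotationSystem.graph.Dart :=
    ⟨(⟨a, T.adj_mem hab⟩, ⟨b, T.adj_mem (T.symm hab)⟩), hab⟩
  refine ⟨o, fun d => ⟨fun h => ?_, fun h => ?_⟩⟩
  · obtain ⟨n, rfl⟩ := Equiv.Perm.SameCycle.exists_nat_pow_eq h
    clear h
    induction n with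
    | zero => exact ho
    | succ n ih =>
      rw [pow_succ', Equiv.Perm.mul_apply]
      exact T.outer_step ih
  · have key : ∀ q, ReflTransGen (fun p p' : V × V => p ∈ T.outer ∧ (p.2, T.next p.2 p.1) = p')
        (a, b) q → ∃ h : T.adj q.1 q.2, T.toRotationSystem.SameFace o
          ⟨(⟨q.1, T.adj_mem h⟩, ⟨q.2, T.adj_mem (T.symm h)⟩), h⟩ := by
      intro q hq
      induction hq with
      | refl => exact ⟨hab, .refl _ _⟩
      | tail _ h ih =>
        obtain ⟨h1, ih⟩ := ih
        obtain ⟨-, rfl⟩ := h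
        exact ⟨T.next_adj (T.symm h1), ih.apply_right⟩
    exact (key _ (hconn _ h)).2

theorem exists_nearTriangulation :
    ∃ Q : NearTriangulation {w // w ∈ T.verts}, Q.graph = T.graph := by
  obtain ⟨o, ho⟩ := T.sameFace_toRotationSystem
  have htri : ∀ d, ¬ T.toRotationSystem.SameFace o d → T.toRotationSystem.faceSize d = 3 := by
    intro d hd
    rw [ho] at hd
    obtain ⟨h1, h2⟩ := T.tri d.adj hd
    refine Equiv.Perm.ncard_sameCycle_eq_three (T.toRotationSystem.facePerm_ne d) ?_
    refine Dart.ext _ _ (Prod.ext (Subtype.ext h1) (Subtype.ext ?_))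
    change T.next (T.next (T.next d.snd d.fst) d.snd) (T.next d.snd d.fst) = d.snd
    rw [h1, h2]
  have hinj : Function.Injective
      (Prod.map Subtype.val Subtype.val : {w // w ∈ T.verts} × {w // w ∈ T.verts} → V × V) :=
    Subtype.val_injective.prodMap Subtype.val_injective
  refine ⟨⟨T.toRotationSystem, o, (T.toRotationSystem.isPlane_iff o htri).2 ?_, htri⟩, rfl⟩
  rw [Fintype.card_coe, T.euler]
  have h1 : {p : V × V | T.adj p.1 p.2} =
      Prod.map Subtype.val Subtype.val '' {p : _ × _ | T.graph.Adj p.1 p.2} := by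
    ext ⟨u, w⟩
    constructor
    · intro h
      exact ⟨(⟨u, T.adj_mem h⟩, ⟨w, T.adj_mem (T.symm h)⟩), h, rfl⟩
    · rintro ⟨p, hp, he⟩
      exact he ▸ hp
  have h2 : T.outer = (Prod.map Subtype.val Subtype.val ∘ Dart.toProd) ''
      {d | T.toRotationSystem.SameFace o d} := by
    ext ⟨u, w⟩
    constructor
    · intro h
      have hadj := T.outer_adj h
      exact ⟨⟨(⟨u, T.adj_mem hadj⟩, ⟨w, T.adj_mem (T.symm hadj)⟩), hadj⟩, (ho _).2 h, rfl⟩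
    · rintro ⟨d, hd, he⟩
      exact he ▸ (ho d).1 hd
  rw [h1, h2, Set.ncard_image_of_injective _ hinj,
    Set.ncard_image_of_injective _ (hinj.comp Dart.toProd_injective)]
  rfl

end TriMap

theorem TriMap.exists_coloring {V : Type} [Fintype V] [DecidableEq V] (T : TriMap V)
    (hcard : T.verts.card < Fintype.card V)
    (L : V → Finset ℕ) (hL : ∀ v : V, 6 ≤ (L v).card)
    (hmin : ∀ (W : Type) [Fintype W] [DecidableEq W] (Q : NearTriangulation W),
      Fintype.card W < Fintype.card V →
      ∀ L' : W → Finset ℕ, (∀ w : W, 6 ≤ (L' w).card) →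
        ∃ φ : W → ℕ, (∀ w : W, φ w ∈ L' w) ∧ IsDynColoring Q.graph 3 φ) :
    ∃ φ : V → ℕ, (∀ w ∈ T.verts, φ w ∈ L w) ∧ (∀ u w, T.adj u w → φ u ≠ φ w) ∧
      ∀ u ∈ T.verts, min 3 {w | T.adj u w}.ncard ≤ (φ '' {w | T.adj u w}).ncard := by
  obtain ⟨Q, hQ⟩ := T.exists_nearTriangulation
  obtain ⟨φ, hφL, hφ⟩ := hmin _ Q (by rwa [Fintype.card_coe]) (fun w => L w) fun w => hL w
  rw [hQ] at hφ
  have hval : ∀ w (hw : w ∈ T.verts),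
      (fun w => if h : w ∈ T.verts then φ ⟨w, h⟩ else 0) w = φ ⟨w, hw⟩ := fun w hw => dif_pos hw
  refine ⟨fun w => if h : w ∈ T.verts then φ ⟨w, h⟩ else 0, fun w hw => ?_, fun u w h => ?_,
    fun u hu => ?_⟩
  · rw [hval w hw]
    exact hφL _
  · rw [hval u (T.adj_mem h), hval w (T.adj_mem (T.symm h))]
    exact hφ.1 (u := ⟨u, _⟩) (v := ⟨w, _⟩) h
  · have himg : {w | T.adj u w} = Subtype.val '' T.graph.neighborSet ⟨u, hu⟩ := by
      ext w
      constructor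
      · intro h
        exact ⟨⟨w, T.adj_mem (T.symm h)⟩, h, rfl⟩
      · rintro ⟨w, h, rfl⟩
        exact h
    rw [himg, Set.ncard_image_of_injective _ Subtype.val_injective, Set.image_image]
    convert hφ.2 ⟨u, hu⟩ using 3 with w
    exact hval w w.2

/-- Extending a coloring of a graph containing `G - v` to a `3`-dynamic coloring of `G`. The
larger graph `A` may join two neighbors `a` and `b` of `v`, and `F` collects the colors
forbidden at `v`. -/
theorem exists_isDynColoring_of_delete {V : Type} [Finite V] [DecidableEq V] {G : SimpleGraph V}
    {A : V → V → Prop} {v a b : V} {L : V → Finset ℕ} {φ : V → ℕ} (hva : G.Adj v a)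
    (hvb : G.Adj v b)
    (hA : ∀ u w, A u w ↔ (G.Adj u w ∧ u ≠ v ∧ w ≠ v) ∨ (u = a ∧ w = b) ∨ (u = b ∧ w = a))
    (hclique : ∀ u w, G.Adj v u → G.Adj v w → u ≠ w → A u w)
    (hL : 6 ≤ (L v).card) (hφL : ∀ w ≠ v, φ w ∈ L w) (hφ : ∀ u w, A u w → φ u ≠ φ w)
    (hdyn : ∀ u ≠ v, min 3 {w | A u w}.ncard ≤ (φ '' {w | A u w}).ncard)
    {F : Finset ℕ} (hF : F.card ≤ 5) (hvF : ∀ w, G.Adj v w → φ w ∈ F)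
    (hMF : ∀ u, G.Adj v u → 3 ≤ (φ '' {w | G.Adj u w ∧ w ≠ v}).ncard ∨
      φ '' {w | G.Adj u w ∧ w ≠ v} ⊆ F) :
    ∃ ψ : V → ℕ, (∀ w, ψ w ∈ L w) ∧ IsDynColoring G 3 ψ := by
  obtain ⟨c, hcL, hcF⟩ := Finset.exists_mem_notMem_of_card_lt_card (s := F) (t := L v) (by omega)
  have hself : Function.update φ v c v = c := Function.update_self ..
  have hof : ∀ w, w ≠ v → Function.update φ v c w = φ w := fun w hw =>
    Function.update_of_ne hw ..
  have himg : ∀ s : Set V, v ∉ s → Function.update φ v c '' s = φ '' s := fun s hs =>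
    Set.image_congr fun w hw => hof w fun h => hs (h ▸ hw)
  refine ⟨Function.update φ v c, fun w => ?_, fun u w h => ?_, fun u => ?_⟩
  · by_cases hw : w = v
    · rwa [hw, hself]
    · rw [hof w hw]
      exact hφL w hw
  · by_cases hu : u = v
    · subst hu
      rw [hself, hof w h.ne']
      exact fun hc => hcF (hc ▸ hvF w h)
    · by_cases hw : w = v
      · subst hw
        rw [hself, hof u hu]
        exact fun hc => hcF (hc ▸ hvF u h.symm)
      · rw [hof u hu, hof w hw]
        exact hφ u w ((hA u w).2 (.inl ⟨h, hu, hw⟩))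
  · by_cases hu : u = v
    · subst hu
      rw [himg (G.neighborSet u) fun h => G.irrefl h, Set.InjOn.ncard_image]
      · exact min_le_right ..
      · intro y hy z hz h
        by_contra hne
        exact hφ y z (hclique y z hy hz hne) h
    have hdyn := hdyn u hu
    by_cases huv : G.Adj v u
    · have hN : G.neighborSet u = insert v {w | G.Adj u w ∧ w ≠ v} := by
        ext w
        by_cases hw : w = v <;> simp [hw, huv.symm]
      have hvM : v ∉ {w | G.Adj u w ∧ w ≠ v} := fun h => h.2 rfl
      rw [hN, Set.image_insert_eq, hself, himg _ hvM, Set.ncard_insert_of_notMem hvM]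
      rcases hMF u huv with h3 | hM
      · exact (min_le_left ..).trans (h3.trans (Set.ncard_le_ncard (Set.subset_insert ..)))
      rw [Set.ncard_insert_of_notMem fun h => hcF (hM h)]
      obtain ⟨z, hz⟩ : ∃ z, {w | A u w} = {w | G.Adj u w ∧ w ≠ v} ∨
          {w | A u w} = insert z {w | G.Adj u w ∧ w ≠ v} := by
        by_cases hua : u = a
        · refine ⟨b, .inr ?_⟩
          ext w
          simp only [Set.mem_ofPred_eq, Set.mem_insert_iff, hA]
          have := hvb.ne'
          grind
        · by_cases hub : u = b
          · refine ⟨a, .inr ?_⟩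
            ext w
            simp only [Set.mem_ofPred_eq, Set.mem_insert_iff, hA]
            grind
          · refine ⟨a, .inl ?_⟩
            ext w
            simp only [Set.mem_ofPred_eq, hA]
            grind
      rcases hz with hz | hz
      · rw [hz] at hdyn
        omega
      · by_cases hzM : z ∈ {w | G.Adj u w ∧ w ≠ v}
        · rw [hz, Set.insert_eq_of_mem hzM] at hdyn
          omega
        · rw [hz, Set.image_insert_eq, Set.ncard_insert_of_notMem hzM] at hdyn
          exact hdyn.trans (Set.ncard_insert_le ..)
    · have hN : G.neighborSet u = {w | A u w} := by
        ext w
        simp only [Set.mem_ofPred_eq, hA, mem_neighborSet]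
        constructor
        · exact fun h => .inl ⟨h, hu, fun hw => huv (hw ▸ h).symm⟩
        · rintro (h | ⟨rfl, -⟩ | ⟨rfl, -⟩)
          · exact h.1
          · exact absurd hva huv
          · exact absurd hvb huv
      rwa [himg (G.neighborSet u) fun h : G.Adj u v => huv h.symm, hN]

theorem Set.three_le_ncard_or_subset_pair {α : Type*} {s : Set α} (hs : s.Finite) {y : α}
    (hy : y ∈ s) : ∃ e, 3 ≤ s.ncard ∨ s ⊆ {y, e} := by
  by_cases h : 3 ≤ s.ncard
  · exact ⟨y, .inl h⟩
  · by_cases h1 : s ⊆ {y}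
    · exact ⟨y, .inr (by simpa using h1)⟩
    · obtain ⟨e, he, hey⟩ := Set.not_subset.1 h1
      refine ⟨e, .inr (Set.eq_of_subset_of_ncard_le ?_ ?_ hs).symm.subset⟩
      · rintro z (rfl | rfl) <;> assumption
      · rw [Set.ncard_pair fun h => hey h.symm]
        omega

theorem exists_isDynColoring_of_delete_of_card_le_three {V : Type} [Finite V] [DecidableEq V]
    {G : SimpleGraph V} {A : V → V → Prop} {v a x b : V} {L : V → Finset ℕ} {φ : V → ℕ}
    (hN : ∀ w, G.Adj v w ↔ w = a ∨ w = x ∨ w = b) (hax : G.Adj a x) (hab : a ≠ b)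
    (hxb : x ≠ b → G.Adj x b)
    (hA : ∀ u w, A u w ↔ (G.Adj u w ∧ u ≠ v ∧ w ≠ v) ∨ (u = a ∧ w = b) ∨ (u = b ∧ w = a))
    (hL : 6 ≤ (L v).card) (hφL : ∀ w ≠ v, φ w ∈ L w) (hφ : ∀ u w, A u w → φ u ≠ φ w)
    (hdyn : ∀ u ≠ v, min 3 {w | A u w}.ncard ≤ (φ '' {w | A u w}).ncard) :
    ∃ ψ : V → ℕ, (∀ w, ψ w ∈ L w) ∧ IsDynColoring G 3 ψ := by
  have hva : G.Adj v a := (hN a).2 (.inl rfl)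
  have hvx : G.Adj v x := (hN x).2 (.inr (.inl rfl))
  have hvb : G.Adj v b := (hN b).2 (.inr (.inr rfl))
  have hclique : ∀ u w, G.Adj v u → G.Adj v w → u ≠ w → A u w := by
    intro u w hu hw hne
    rw [hA]
    have h1 := hu.ne'
    have h2 := hw.ne'
    have h3 := hax.symm
    have h4 := fun h => (hxb h).symm
    rw [hN] at hu hw
    grind
  have hmem : ∀ {u w}, G.Adj u w → w ≠ v → φ w ∈ φ '' {w | G.Adj u w ∧ w ≠ v} :=
    fun h h' => ⟨_, ⟨h, h'⟩, rfl⟩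
  obtain ⟨ea, hea⟩ := Set.three_le_ncard_or_subset_pair (Set.toFinite _)
    (hmem hax hvx.ne')
  by_cases hxb' : x = b
  · subst hxb'
    obtain ⟨ex, hex⟩ := Set.three_le_ncard_or_subset_pair (Set.toFinite _)
      (hmem hax.symm hva.ne')
    refine exists_isDynColoring_of_delete hva hvb hA hclique hL hφL hφ hdyn
      (F := {φ a, φ x, ea, ex}) (Finset.card_le_four.trans (by norm_num)) ?_ ?_
    · intro w hw
      rw [hN] at hw
      rcases hw with rfl | rfl | rfl <;> simp
    · intro w hw
      rw [hN] at hw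
      rcases hw with rfl | rfl | rfl
      · exact hea.imp_right fun h => h.trans (by simp [Set.insert_subset_iff])
      · exact hex.imp_right fun h => h.trans (by simp [Set.insert_subset_iff])
      · exact hex.imp_right fun h => h.trans (by simp [Set.insert_subset_iff])
  · obtain ⟨eb, heb⟩ := Set.three_le_ncard_or_subset_pair (Set.toFinite _)
      (hmem (hxb hxb').symm hvx.ne')
    obtain ⟨ex, hex⟩ := Set.three_le_ncard_or_subset_pair (Set.toFinite _)
      (hmem hax.symm hva.ne')
    have hex' : 3 ≤ (φ '' {w | G.Adj x w ∧ w ≠ v}).ncard ∨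
        φ '' {w | G.Adj x w ∧ w ≠ v} ⊆ {φ a, φ b} := by
      refine hex.imp_right fun h => ?_
      have hne : φ b ≠ φ a := (hφ _ _ (hclique a b hva hvb hab)).symm
      have h1 := h (hmem (hxb hxb') hvb.ne')
      obtain rfl : φ b = ex := by simpa [hne] using h1
      exact h
    refine exists_isDynColoring_of_delete hva hvb hA hclique hL hφL hφ hdyn
      (F := {φ a, φ x, φ b, ea, eb}) Finset.card_le_five ?_ ?_
    · intro w hw
      rw [hN] at hw
      rcases hw with rfl | rfl | rfl <;> simp
    · intro w hw
      rw [hN] at hw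
      rcases hw with rfl | rfl | rfl
      · exact hea.imp_right fun h => h.trans (by simp [Set.insert_subset_iff])
      · exact hex'.imp_right fun h => h.trans (by simp [Set.insert_subset_iff])
      · exact heb.imp_right fun h => h.trans (by simp [Set.insert_subset_iff])

/-- Delete a vertex of degree at most three from the outer face of a map, joining its two
neighbors on the outer face. -/
theorem TriMap.exists_deleteVertex {V : Type} [Finite V] [DecidableEq V] (T : TriMap V)
    (hinj : Set.InjOn Prod.fst T.outer) {v a : V} (hva : (v, a) ∈ T.outer)
    (hdeg : {w | T.adj v w}.ncard ≤ 3) :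
    (∀ w ∈ T.verts, w = v ∨ w = a) ∨
    ∃ x b, (∀ w, T.adj v w ↔ w = a ∨ w = x ∨ w = b) ∧ T.adj a x ∧ a ≠ b ∧
      (x ≠ b → T.adj x b) ∧ ∃ T' : TriMap V, T'.verts = T.verts.erase v ∧
        ∀ u w, T'.adj u w ↔
          (T.adj u w ∧ u ≠ v ∧ w ≠ v) ∨ (u = a ∧ w = b) ∨ (u = b ∧ w = a) := by
  have hadj := T.outer_adj hva
  have hne : ∀ {u w}, T.adj u w → u ≠ w := by
    rintro u _ h rfl
    exact T.irrefl u h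
  have hout : ∀ {u w w'}, (u, w) ∈ T.outer → (u, w') ∈ T.outer → w = w' :=
    fun h h' => congrArg Prod.snd (hinj h h' rfl)
  obtain ⟨x, hx⟩ : ∃ x, T.next v a = x := ⟨_, rfl⟩
  have hvx : T.adj v x := hx ▸ T.next_adj hadj
  by_cases hxa : x = a
  · left
    subst hxa
    have h1 : (x, v) ∈ T.outer := T.mem_outer_of_step (T.symm hadj) (hx.symm ▸ hva)
    have h2 : T.next x v = v := (hout h1 (T.outer_step hva)).symm
    intro w hw
    have hconn := T.conn v (T.adj_mem hadj) w hw
    induction hconn with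
    | refl => exact .inl rfl
    | tail _ h ih =>
      rcases ih (T.adj_mem h) with rfl | rfl
      · exact .inr ((T.cyclic _).eq_of_fixed hadj hx h)
      · exact .inl ((T.cyclic _).eq_of_fixed (T.symm hadj) h2 h)
  right
  have hvxO : (v, x) ∉ T.outer := fun h => hxa (hout h hva)
  have havO : (a, v) ∉ T.outer := fun h => hvxO (hx ▸ T.outer_step h)
  obtain ⟨hxv, hav⟩ := T.tri (T.symm hadj) havO
  rw [hx] at hxv hav
  have hax : T.adj a x := T.symm (hxv ▸ T.next_adj (T.symm hvx))
  obtain ⟨b, hb⟩ : ∃ b, T.next v x = b := ⟨_, rfl⟩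
  have hvb : T.adj v b := hb ▸ T.next_adj hvx
  obtain ⟨T₁, hv₁, hA₁, hnv₁, -, hn₁, hO₁⟩ := T.exists_deleteEdge hva havO
  rw [hx] at hO₁
  have hnx₁ : ∀ w, T₁.next x w = T.next x w := fun w => hn₁ x w (hne hvx).symm hxa
  by_cases hba : b = a
  · subst hba
    have hvx₁ : T₁.adj v x := (hA₁ _ _).2 ⟨hvx, fun h => hxa h.2, fun h => hne hadj h.1⟩
    obtain ⟨T₂, hv₂, hA₂, -⟩ := T₁.exists_deleteLeaf hvx₁ (by rw [hnv₁, skipPoint, if_pos hb, hx])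
      (by rw [hnx₁, hxv]; exact (hne hadj).symm)
    refine ⟨x, x, fun w => ⟨fun h => ?_, ?_⟩, hax, Ne.symm hxa, fun h => absurd rfl h, T₂,
      by rw [hv₂, hv₁], fun u w => ?_⟩
    · have := (T.cyclic v).eq_or_eq hadj (by rw [hx, hb]) h
      rw [hx] at this
      tauto
    · rintro (rfl | rfl | rfl) <;> assumption
    · have hxa' := T.symm hax
      rw [hA₂, hA₁]
      grind
  have hbx : b ≠ x := fun h => hba (((T.cyclic v).eq_of_fixed hvx (hb.trans h) hadj).symm ▸ h)
  have hN : ∀ w, T.adj v w ↔ w = a ∨ w = x ∨ w = b := by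
    have hs : ({a, x, b} : Set V) = {w | T.adj v w} := by
      refine Set.eq_of_subset_of_ncard_le ?_ ?_
      · rintro w (rfl | rfl | rfl) <;> assumption
      · rwa [Set.ncard_eq_three.2 ⟨a, x, b, Ne.symm hxa, Ne.symm hba, hbx.symm, rfl⟩]
    exact fun w => (Set.ext_iff.1 hs w).symm
  have hvb' : T.next v b = a := by
    rcases (hN _).1 (T.next_adj hvb) with h | h | h
    · exact h
    · exact absurd ((T.cyclic v).injOn hvb hadj (h.trans hx.symm)) hba
    · exact absurd ((T.cyclic v).injOn hvb hvx (h.trans hb.symm)) hbx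
  have hxvO : (x, v) ∉ T.outer := fun h => hba (hout (hb ▸ T.outer_step h) hva)
  obtain ⟨hbv, hxb⟩ := T.tri (T.symm hvx) hxvO
  rw [hb] at hbv hxb
  have hbx' : T.adj b x := hbv ▸ T.next_adj (T.symm hvb)
  refine ⟨x, b, hN, hax, Ne.symm hba, fun _ => T.symm hbx', ?_⟩
  have hnvx₁ : T₁.next v x = b := by rw [hnv₁, skipPoint, hb, if_neg hba]
  have hvxO₁ : (v, x) ∈ T₁.outer := by simp [hO₁]
  have hxvO₁ : (x, v) ∉ T₁.outer := by
    simp [hO₁, hne hadj, hxvO, (hne hvx).symm]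
  obtain ⟨T₂, hv₂, hA₂, hnv₂, hnx₂, hn₂, hO₂⟩ := T₁.exists_deleteEdge hvxO₁ hxvO₁
  rw [hnvx₁] at hO₂
  have hvb₂ : T₂.adj v b := by
    rw [hA₂, hA₁]
    exact ⟨⟨hvb, fun h => hba h.2, fun h => hne hadj h.1⟩, fun h => hbx h.2, fun h => hne hvx h.1⟩
  obtain ⟨T₃, hv₃, hA₃, -, hn₃, hO₃⟩ := T₂.exists_deleteLeaf hvb₂
    (by rw [hnv₂, skipPoint, hnv₁, skipPoint, if_pos hvb', hx, if_pos rfl, hnvx₁])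
    (by rw [hn₂ b v (hne hvb).symm hbx, hn₁ b v (hne hvb).symm hba, hbv]; exact (hne hvx).symm)
  have hbxO₃ : (b, x) ∈ T₃.outer := by
    simp [hO₃, hO₂, (hne hvb).symm, (hne hvx).symm]
  have hxb₃ : T₃.next x b = a := by
    rw [hn₃ x b hbx.symm, hnx₂, skipPoint, hnx₁, hnx₁, hxb, if_pos rfl, hxv]
  have hA : ∀ u w, T₃.adj u w ↔ T.adj u w ∧ u ≠ v ∧ w ≠ v := by
    intro u w
    rw [hA₃, hA₂, hA₁]
    grind
  have hverts : T₃.verts = T.verts.erase v := by rw [hv₃, hv₂, hv₁]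
  by_cases hab : T₃.adj a b
  · refine ⟨T₃, hverts, fun u w => ?_⟩
    have hba' := T₃.symm hab
    rw [← hA]
    grind
  · obtain ⟨T₄, hv₄, hA₄⟩ := T₃.exists_addEdge hbxO₃ hxb₃ hba hab
    exact ⟨T₄, hv₄.trans hverts, fun u w => by rw [hA₄, hA]⟩

theorem exists_isDynColoring_of_two_vertices {V : Type} [Finite V] [DecidableEq V]
    {G : SimpleGraph V} {v a : V} (hV : ∀ w, w = v ∨ w = a) (L : V → Finset ℕ)
    (hL : ∀ w, 2 ≤ (L w).card) : ∃ φ : V → ℕ, (∀ w, φ w ∈ L w) ∧ IsDynColoring G 3 φ := by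
  obtain ⟨c, hc⟩ := Finset.card_pos.1 (lt_of_lt_of_le two_pos (hL v))
  obtain ⟨d, hd, hdc⟩ := Finset.exists_mem_ne (hL a) c
  refine ⟨fun w => if w = v then c else d, fun w => ?_, fun u w h => ?_, fun u => ?_⟩
  · by_cases hw : w = v
    · simpa [hw] using hc
    · obtain rfl := (hV w).resolve_left hw
      simpa [hw] using hd
  · have := h.ne
    have := hV u
    have := hV w
    grind
  · rw [Set.InjOn.ncard_image]
    · exact min_le_right ..
    · intro y hy z hz _
      have := hV u
      have := hV y
      have := hV z
      have := (G.ne_of_adj hy)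
      have := (G.ne_of_adj hz)
      grind

/-- **Claim 2.1.** Let `G` be a near-triangulation whose outer face is bounded by a cycle,
which is not 3-dynamically colorable from some list assignment with all lists of size at
least `6`, and which is vertex-minimal with this property (every near-triangulation with
fewer vertices is 3-dynamically 6-choosable). Then every vertex on the boundary cycle of
the outer face has degree at least `4` in `G`. -/
theorem minimal_counterexample_outer_degree_ge_four {V : Type} [Fintype V] [DecidableEq V]
    (P : NearTriangulation V)
    (hcyc : Set.InjOn (fun d : P.graph.Dart => d.fst)
      {d : P.graph.Dart | P.toRotationSystem.SameFace P.outer d})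
    (L : V → Finset ℕ) (hL : ∀ v : V, 6 ≤ (L v).card)
    (hbad : ¬ ∃ φ : V → ℕ, (∀ v : V, φ v ∈ L v) ∧ IsDynColoring P.graph 3 φ)
    (hmin : ∀ (W : Type) [Fintype W] [DecidableEq W] (Q : NearTriangulation W),
      Fintype.card W < Fintype.card V →
      ∀ L' : W → Finset ℕ, (∀ w : W, 6 ≤ (L' w).card) →
        ∃ φ : W → ℕ, (∀ w : W, φ w ∈ L' w) ∧ IsDynColoring Q.graph 3 φ) :
    ∀ v : V, P.OnOuter v → 4 ≤ (P.graph.neighborSet v).ncard := by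
  rintro v ⟨d, hd, rfl⟩
  by_contra hdeg
  have hva : (d.fst, d.snd) ∈ P.toTriMap.outer := ⟨d.adj, hd⟩
  have hinj : Set.InjOn Prod.fst P.toTriMap.outer := by
    rintro p ⟨hp, hp'⟩ q ⟨hq, hq'⟩ h
    exact congrArg Dart.toProd (hcyc hp' hq' h)
  rcases P.toTriMap.exists_deleteVertex hinj hva (Nat.le_of_lt_succ (not_le.1 hdeg)) with
    hV | ⟨x, b, hN, hax, hab, hxb, T, hverts, hadj⟩
  · exact hbad (exists_isDynColoring_of_two_vertices (fun w => hV w (Finset.mem_univ w)) L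
      fun w => le_trans (by norm_num) (hL w))
  · have hmem : ∀ w, w ∈ T.verts ↔ w ≠ d.fst := by
      simp [hverts, NearTriangulation.toTriMap]
    obtain ⟨φ, hφL, hφ, hdyn⟩ := T.exists_coloring (by
      rw [hverts]
      exact Finset.card_erase_lt_of_mem (Finset.mem_univ _)) L hL hmin
    exact hbad (exists_isDynColoring_of_delete_of_card_le_three hN hax hab hxb hadj (hL _)
      (fun w hw => hφL w ((hmem w).2 hw)) hφ fun u hu => hdyn u ((hmem u).2 hu))
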